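/- arXiv:1209.0890 — 2 statements merged into one kernel-verified Lean document; each statement's English description precedes it below -/
import Mathlib

section
/- There exists a strictly increasing sequence (V_n)_{n ∈ ℕ} of additive subgroups of the real numbers ℝ such that each V_n is a proper subgroup of ℝ and the union of all the V_n is ℝ. -/
/-- A module with an infinite basis is the union of a strictly increasing sequence of submodules:
the `n`-th one consists of the vectors whose coordinates along a fixed sequence of basis vectors
vanish from index `n` on. -/
theorem Module.Basis.exists_submodule_seq_lt_succ {ι R M : Type*} [Semiring R] [Nontrivial R]
    [AddCommMonoid M] [Module R M] [Infinite ι] (b : Module.Basis ι R M) :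
    ∃ W : ℕ → Submodule R M, (∀ n, W n < W (n + 1)) ∧ ∀ x, ∃ n, x ∈ W n := by
  let e := Infinite.natEmbedding ι
  have mem (n : ℕ) (x : M) :
      x ∈ ⨅ k ≥ n, LinearMap.ker (b.coord (e k)) ↔ ∀ k ≥ n, b.repr x (e k) = 0 := by
    simp [Submodule.mem_iInf]
  refine ⟨fun n => ⨅ k ≥ n, LinearMap.ker (b.coord (e k)), fun n => ?_, fun x => ?_⟩
  · refine SetLike.lt_iff_le_and_exists.2 ⟨fun x hx => ?_, b (e n), ?_, fun h => ?_⟩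
    · exact (mem _ _).2 fun k hk => (mem _ _).1 hx k (Nat.le_of_succ_le hk)
    · refine (mem _ _).2 fun k hk => ?_
      rw [b.repr_self, Finsupp.single_eq_of_ne (e.injective.ne (by omega))]
    · simpa using (mem _ _).1 h n le_rfl
  · obtain ⟨N, hN⟩ := ((b.repr x).support.preimage e e.injective.injOn).bddAbove
    refine ⟨N + 1, (mem _ _).2 fun k hk => ?_⟩
    by_contra h
    have : k ≤ N := hN (by simpa using h)
    omega

/-- **Remark 1.** There is a strictly increasing sequence of proper additive
subgroups of `ℝ` whose union is all of `ℝ`. -/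
theorem exists_strictMono_proper_addSubgroups_real :
    ∃ V : ℕ → AddSubgroup ℝ,
      (∀ n, V n < V (n + 1)) ∧ (∀ n, V n ≠ ⊤) ∧ (⋃ n, (V n : Set ℝ)) = Set.univ := by
  let b := Module.Basis.ofVectorSpace ℚ ℝ
  have : Infinite (Module.Basis.ofVectorSpaceIndex ℚ ℝ) := by
    rw [Cardinal.infinite_iff, b.mk_eq_rank'', Real.rank_rat_real]
    exact Cardinal.aleph0_le_continuum
  obtain ⟨W, hlt, hx⟩ := b.exists_submodule_seq_lt_succ
  have hV (n : ℕ) : (W n).toAddSubgroup < (W (n + 1)).toAddSubgroup :=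
    Submodule.toAddSubgroup_strictMono (hlt n)
  exact ⟨fun n => (W n).toAddSubgroup, hV, fun n => (hV n).ne_top,
    Set.eq_univ_of_forall fun x => Set.mem_iUnion.2 (hx x)⟩
end

section
/- For every real number p > 0, there exists a strictly increasing sequence (W_n)_{n ∈ ℕ} of additive subgroups of the circle group ℝ/pℤ such that each W_n is a proper subgroup and the union of all the W_n is all of ℝ/pℤ. -/
/-- There are additive maps `φ 0, φ 1, …` from the circle group to `ℚ`, with a dual family of
points, such that every point is annihilated by all but finitely many `φ k`. -/
lemma AddCircle.exists_dual_addMonoidHom_rat (p : ℝ) :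
    ∃ (φ : ℕ → AddCircle p →+ ℚ) (e : ℕ → AddCircle p),
      (∀ n, φ n (e n) = 1) ∧ (∀ k n, k ≠ n → φ k (e n) = 0) ∧
        ∀ x, ∃ N, ∀ k, N ≤ k → φ k x = 0 := by
  let b := Module.Basis.ofVectorSpace ℚ ℝ
  have hinf : Infinite (Module.Basis.ofVectorSpaceIndex ℚ ℝ) := by
    rw [Cardinal.infinite_iff, b.mk_eq_rank'', Real.rank_rat_real]
    exact Cardinal.aleph0_le_continuum
  let f := Infinite.natEmbedding (Module.Basis.ofVectorSpaceIndex ℚ ℝ)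
  have hfin (x : ℝ) : ∃ N, ∀ k, N ≤ k → b.repr x (f k) = 0 := by
    have hs : {k | b.repr x (f k) ≠ 0}.Finite :=
      Set.Finite.preimage f.injective.injOn (b.repr x).hasFiniteSupport
    obtain ⟨M, hM⟩ := hs.bddAbove
    refine ⟨M + 1, fun k hk ↦ ?_⟩
    by_contra h
    have := hM h
    omega
  obtain ⟨N, hN⟩ := hfin p
  refine ⟨fun k ↦ QuotientAddGroup.lift _ (b.coord (f (N + k))).toAddMonoidHom ?_,
    fun n ↦ (b (f (N + n)) : AddCircle p), fun n ↦ ?_, fun k n hkn ↦ ?_, fun x ↦ ?_⟩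
  · rw [AddSubgroup.zmultiples_le]
    exact hN _ (Nat.le_add_right N k)
  · change b.repr (b (f (N + n))) (f (N + n)) = 1
    simp
  · change b.repr (b (f (N + n))) (f (N + k)) = 0
    rw [b.repr_self, Finsupp.single_eq_of_ne]
    intro h
    have := f.injective h
    omega
  · induction x using QuotientAddGroup.induction_on with
    | H x =>
      obtain ⟨M, hM⟩ := hfin x
      exact ⟨M, fun k hk ↦ hM (N + k) (by omega)⟩

/-- **Remark 1.** For every real `p > 0`, there is a strictly increasing
sequence of proper additive subgroups of the circle group `ℝ/pℤ` whose union is the whole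
circle. -/
theorem exists_strictMono_proper_addSubgroups_addCircle (p : ℝ) (hp : 0 < p) :
    ∃ W : ℕ → AddSubgroup (AddCircle p),
      (∀ n, W n < W (n + 1)) ∧ (∀ n, W n ≠ ⊤) ∧
        (⋃ n, (W n : Set (AddCircle p))) = Set.univ := by
  obtain ⟨φ, e, he, hne, hfin⟩ := AddCircle.exists_dual_addMonoidHom_rat p
  let W (n : ℕ) : AddSubgroup (AddCircle p) := ⨅ k, ⨅ (_ : n ≤ k), (φ k).ker
  have hW (n : ℕ) (x : AddCircle p) : x ∈ W n ↔ ∀ k, n ≤ k → φ k x = 0 := by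
    simp [W, AddSubgroup.mem_iInf, AddMonoidHom.mem_ker]
  have hlt (n : ℕ) : W n < W (n + 1) := by
    refine SetLike.lt_iff_le_and_exists.2 ⟨fun x hx ↦ ?_, e n, ?_, fun h ↦ ?_⟩
    · exact (hW _ _).2 fun k hk ↦ (hW _ _).1 hx k (by omega)
    · exact (hW _ _).2 fun k hk ↦ hne k n (by omega)
    · exact one_ne_zero ((he n).symm.trans ((hW _ _).1 h n le_rfl))
  refine ⟨W, hlt, fun n ↦ (hlt n).ne_top, Set.eq_univ_of_forall fun x ↦ ?_⟩
  obtain ⟨N, hN⟩ := hfin x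
  exact Set.mem_iUnion.2 ⟨N, (hW _ _).2 hN⟩
end
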